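/- Let t be a tree with isBST t, and let s = node ls ks ds rs be a subtree of t, i.e. s ∈ Subtrees t. Then for every x : ℤ, Map t x = if x = ks then some ds else MapP t s x; equivalently, Map t = MapP t s † {ks ↦ ds}. -/

import Mathlib

inductive BTree where
  | leaf : BTree
  | node : BTree → ℤ → ℤ → BTree → BTree
deriving DecidableEq

open BTree

def Dom : BTree → Set ℤ
  | leaf => ∅
  | node l k _ r => {k} ∪ Dom l ∪ Dom r

def isBST : BTree → Prop
  | leaf => True
  | node l k _ r => isBST l ∧ isBST r ∧ (∀ y ∈ Dom l, y < k) ∧ (∀ y ∈ Dom r, k < y)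

def Map : BTree → ℤ → Option ℤ
  | leaf, _ => none
  | node l k d r, x =>
      (Map r x).orElse fun _ =>
        (Map l x).orElse fun _ =>
          if x = k then some d else none

def Subtrees : BTree → Set BTree
  | leaf => ∅
  | node l k d r => {node l k d r} ∪ Subtrees l ∪ Subtrees r

def MapP : BTree → BTree → ℤ → Option ℤ
  | leaf, _, _ => none
  | node l k d r, s, x =>
      (MapP r s x).orElse fun _ =>
        (MapP l s x).orElse fun _ =>
          if node l k d r = s then none
          else if x = k then some d else none

theorem mem_dom_of_mem_subtrees {t l r : BTree} {k d : ℤ}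
    (h : node l k d r ∈ Subtrees t) : k ∈ Dom t := by
  induction t with
  | leaf => simp [Subtrees] at h
  | node l' k' d' r' ihl ihr =>
    simp only [Subtrees, Set.mem_union, Set.mem_singleton_iff, node.injEq] at h
    simp only [Dom, Set.mem_union, Set.mem_singleton_iff]
    tauto

theorem map_eq_none_of_notMem_dom {t : BTree} {x : ℤ} (h : x ∉ Dom t) : Map t x = none := by
  induction t with
  | leaf => rfl
  | node l k d r ihl ihr =>
    simp only [Dom, Set.mem_union, Set.mem_singleton_iff, not_or] at h
    simp [Map, ihl h.1.2, ihr h.2, h.1.1]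

theorem mapP_eq_map_of_notMem_dom {t l r : BTree} {k d : ℤ} (h : k ∉ Dom t) (x : ℤ) :
    MapP t (node l k d r) x = Map t x := by
  induction t with
  | leaf => rfl
  | node l' k' d' r' ihl ihr =>
    simp only [Dom, Set.mem_union, Set.mem_singleton_iff, not_or] at h
    have hk : k' ≠ k := Ne.symm h.1.1
    simp [Map, MapP, ihl h.1.2, ihr h.2, hk]

theorem map_eq_mapP_override (t ls rs : BTree) (ks ds : ℤ)
    (hbst : isBST t) (hs : node ls ks ds rs ∈ Subtrees t) :
    ∀ x : ℤ, Map t x =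
      if x = ks then some ds else MapP t (node ls ks ds rs) x := by
  intro x
  induction t with
  | leaf => simp [Subtrees] at hs
  | node l k d r ihl ihr =>
    obtain ⟨hl, hr, hlt, hgt⟩ := hbst
    simp only [Subtrees, Set.mem_union, Set.mem_singleton_iff] at hs
    rcases hs with (heq | hsl) | hsr
    · obtain ⟨rfl, rfl, rfl, rfl⟩ := node.inj heq
      have hkl : ks ∉ Dom ls := fun h => lt_irrefl _ (hlt _ h)
      have hkr : ks ∉ Dom rs := fun h => lt_irrefl _ (hgt _ h)
      by_cases hx : x = ks
      · subst hx
        simp [Map, map_eq_none_of_notMem_dom hkl, map_eq_none_of_notMem_dom hkr]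
      · simp [Map, MapP, mapP_eq_map_of_notMem_dom hkl, mapP_eq_map_of_notMem_dom hkr, hx]
    · have hlk := hlt _ (mem_dom_of_mem_subtrees hsl)
      have hkr : ks ∉ Dom r := fun h => lt_asymm hlk (hgt _ h)
      have hne : k ≠ ks := hlk.ne'
      by_cases hx : x = ks
      · subst hx
        simp [Map, ihl hl hsl, map_eq_none_of_notMem_dom hkr]
      · simp [Map, MapP, ihl hl hsl, mapP_eq_map_of_notMem_dom hkr, hx, hne]
    · have hkr := hgt _ (mem_dom_of_mem_subtrees hsr)
      have hkl : ks ∉ Dom l := fun h => lt_asymm hkr (hlt _ h)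
      have hne : k ≠ ks := hkr.ne
      by_cases hx : x = ks
      · subst hx
        simp [Map, ihr hr hsr]
      · simp [Map, MapP, ihr hr hsr, mapP_eq_map_of_notMem_dom hkl, hx, hne]
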